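/- Let x = x_C be the CGHS map x_C(y) = −log(1 + e^{−y}) (which satisfies 0 < x′(y) < 1 for all y). Let f be integrable with f̂(p) = 0 for a.e. p ≤ 0, and let β > 0. Then 0 ≤ N̄^Th_{β,in}[f] − N̄_o[f] ≤ (1/(2β)) ∫_0^∞ |f̂(p)|²/p² dp (an inequality in [0, ∞]). -/

import Mathlib

open MeasureTheory Set Filter
open scoped ENNReal

/-- The Fourier transform `f̂(p) = (2π)^{-1/2} ∫ f(y) e^{-ipy} dy`. -/
noncomputable def ft (f : ℝ → ℂ) (p : ℝ) : ℂ :=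
  (Real.sqrt (2 * Real.pi) : ℂ)⁻¹ *
    ∫ y : ℝ, f y * Complex.exp (-Complex.I * (p : ℂ) * (y : ℂ))

/-- `F̌(k) = (2π)^{-1/2} ∫ f(y) e^{-ik x(y)} dy`. -/
noncomputable def Fk (x : ℝ → ℝ) (f : ℝ → ℂ) (k : ℝ) : ℂ :=
  (Real.sqrt (2 * Real.pi) : ℂ)⁻¹ *
    ∫ y : ℝ, f y * Complex.exp (-Complex.I * (k : ℂ) * (x y : ℂ))

/-- The relativistic black-hole coordinate map `x_R(y) = -e^{-y}`. -/
noncomputable def xR (y : ℝ) : ℝ := -Real.exp (-y)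

/-- The CGHS black-hole coordinate map `x_C(y) = -log(1+e^{-y})`. -/
noncomputable def xC (y : ℝ) : ℝ := -Real.log (1 + Real.exp (-y))

/-- The mean number of spontaneously created particles `N̄_o[f]`. -/
noncomputable def No (x : ℝ → ℝ) (f : ℝ → ℂ) : ℝ≥0∞ :=
  ∫⁻ k in Set.Ioi (0:ℝ), ENNReal.ofReal (‖Fk x f (-k)‖ ^ 2 / (2 * k))

/-- The thermal mean particle number `N̄^Th_β[f]` at inverse temperature `β`. -/
noncomputable def Nth (β : ℝ) (f : ℝ → ℂ) : ℝ≥0∞ :=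
  ∫⁻ p in Set.Ioi (0:ℝ),
    ENNReal.ofReal (‖ft f p‖ ^ 2 / (2 * p * (Real.exp (β * p) - 1)))

/-- translate of `f` by `y₀`. -/
noncomputable def tr (f : ℝ → ℂ) (y₀ : ℝ) : ℝ → ℂ := fun y => f (y - y₀)

/-- The mean number of particles emitted when the incoming state is thermal at inverse
temperature `β`: `N̄^Th_{β,in}[f] = ∫_ℝ |F̌(k)|²/(2k(e^{βk}-1)) dk`. -/
noncomputable def NthIn (x : ℝ → ℝ) (β : ℝ) (f : ℝ → ℂ) : ℝ≥0∞ :=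
  ∫⁻ k : ℝ, ENNReal.ofReal (‖Fk x f k‖ ^ 2 / (2 * k * (Real.exp (β * k) - 1)))


open scoped FourierTransform SchwartzMap ContDiff Topology

theorem continuous_fourier_of_integrable {h : ℝ → ℂ} (hh : Integrable h) : Continuous (𝓕 h) :=
  VectorFourier.fourierIntegral_continuous Real.continuous_fourierChar
    (by fun_prop) hh

theorem integral_fourier_mul_eq {h g : ℝ → ℂ} (hh : Integrable h) (hg : Integrable g) :
    ∫ x, 𝓕 g x * h x = ∫ x, g x * 𝓕 h x := by
  have := VectorFourier.integral_fourierIntegral_smul_eq_flip (μ := volume) (ν := volume)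
    (L := innerₗ ℝ) Real.continuous_fourierChar (by fun_prop) hg hh
  rw [flip_innerₗ] at this
  exact this

theorem fourier_toLp_ae_eq {h : ℝ → ℂ} (h1 : Integrable h) (h2 : MemLp h 2) :
    (𝓕 h2.toLp : Lp ℂ 2 (volume : Measure ℝ)) =ᵐ[volume] 𝓕 h := by
  refine ae_eq_of_integral_contDiff_smul_eq ((Lp.memLp _).locallyIntegrable (by norm_num))
    (continuous_fourier_of_integrable h1).locallyIntegrable ?_
  intro g g_smooth g_cpt
  have hg₁ : HasCompactSupport (Complex.ofRealCLM ∘ g) := g_cpt.comp_left rfl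
  have hg₂ : ContDiff ℝ ∞ (Complex.ofRealCLM ∘ g) := by fun_prop
  set G : 𝓢(ℝ, ℂ) := hg₁.toSchwartzMap hg₂ with hG
  have hGg : ∀ x, G x = (g x : ℂ) := fun x => by simp [hG]
  have e1 : Lp.toTemperedDistribution (𝓕 h2.toLp : Lp ℂ 2 (volume : Measure ℝ)) G
      = Lp.toTemperedDistribution h2.toLp (𝓕 G) := by
    rw [← Lp.fourier_toTemperedDistribution_eq]; rfl
  rw [Lp.toTemperedDistribution_apply, Lp.toTemperedDistribution_apply] at e1
  calc _ = ∫ x, G x • (𝓕 h2.toLp : Lp ℂ 2 (volume : Measure ℝ)) x := by simp [hGg]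
    _ = ∫ x, (𝓕 G) x • (h2.toLp h : ℝ → ℂ) x := e1
    _ = ∫ x, 𝓕 (G : ℝ → ℂ) x * h x := by
      refine integral_congr_ae ?_
      filter_upwards [h2.coeFn_toLp] with x hx
      rw [hx, SchwartzMap.fourier_coe, smul_eq_mul]
    _ = ∫ x, G x * 𝓕 h x := integral_fourier_mul_eq h1 G.integrable
    _ = _ := by simp [hGg]

theorem lintegral_enorm_fourier_sq {h : ℝ → ℂ} (h1 : Integrable h) (h2 : MemLp h 2) :
    ∫⁻ x, ‖𝓕 h x‖ₑ ^ 2 = ∫⁻ x, ‖h x‖ₑ ^ 2 := by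
  have key : eLpNorm (𝓕 h) 2 volume = eLpNorm h 2 volume := by
    rw [← eLpNorm_congr_ae (fourier_toLp_ae_eq h1 h2), ← eLpNorm_congr_ae h2.coeFn_toLp]
    have := Lp.norm_fourier_eq h2.toLp
    rwa [Lp.norm_def, Lp.norm_def, ENNReal.toReal_eq_toReal_iff' (Lp.eLpNorm_ne_top _)
      (Lp.eLpNorm_ne_top _)] at this
  have a := eLpNorm_nnreal_pow_eq_lintegral (f := 𝓕 h) (μ := volume) (p := 2) (by norm_num)
  have b := eLpNorm_nnreal_pow_eq_lintegral (f := h) (μ := volume) (p := 2) (by norm_num)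
  norm_num at a b
  rw [← a, ← b, key]

theorem ft_eq_fourier (h : ℝ → ℂ) (p : ℝ) :
    ft h p = (Real.sqrt (2 * Real.pi) : ℂ)⁻¹ * 𝓕 h ((2 * Real.pi)⁻¹ * p) := by
  rw [ft, Real.fourier_real_eq_integral_exp_smul]
  congr 1
  refine integral_congr_ae (.of_forall fun y => ?_)
  simp only [smul_eq_mul]
  rw [mul_comm]
  congr 2
  push_cast
  have : (Real.pi : ℂ) ≠ 0 := by exact_mod_cast Real.pi_ne_zero
  field_simp

theorem lintegral_comp_const_mul {g : ℝ → ℝ≥0∞} (hg : Measurable g) {a : ℝ} (ha : a ≠ 0) :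
    ∫⁻ x, g (a * x) = ENNReal.ofReal |a⁻¹| * ∫⁻ x, g x := by
  rw [← lintegral_map hg (measurable_const_mul a), Real.map_volume_mul_left ha,
    lintegral_smul_measure, smul_eq_mul]

theorem lintegral_enorm_ft_sq {h : ℝ → ℂ} (h1 : Integrable h) (h2 : MemLp h 2) :
    ∫⁻ p, ‖ft h p‖ₑ ^ 2 = ∫⁻ x, ‖h x‖ₑ ^ 2 := by
  have hc : Measurable fun x => ‖𝓕 h x‖ₑ ^ 2 :=
    (continuous_fourier_of_integrable h1).measurable.enorm.pow_const 2
  have hpi : 0 < 2 * Real.pi := by positivity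
  simp only [ft_eq_fourier, enorm_mul, mul_pow]
  rw [lintegral_const_mul' _ _ (ENNReal.pow_ne_top enorm_ne_top),
    lintegral_comp_const_mul hc (inv_ne_zero hpi.ne'), lintegral_enorm_fourier_sq h1 h2,
    ← mul_assoc]
  have : ‖((Real.sqrt (2 * Real.pi) : ℝ) : ℂ)⁻¹‖ₑ ^ 2 * ENNReal.ofReal |(2 * Real.pi)⁻¹⁻¹| = 1 := by
    rw [← ofReal_norm, ← ENNReal.ofReal_pow (norm_nonneg _), ← ENNReal.ofReal_mul (by positivity),
      norm_inv, Complex.norm_real, inv_pow, Real.norm_eq_abs, sq_abs, Real.sq_sqrt hpi.le, inv_inv,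
      abs_of_pos hpi, inv_mul_cancel₀ hpi.ne', ENNReal.ofReal_one]
  rw [this, one_mul]

theorem lintegral_enorm_sq_le_of_tendsto {F : ℕ → ℝ → ℂ} {g : ℝ → ℂ} {C : ℝ≥0∞}
    (hF : ∀ n, AEStronglyMeasurable (F n) volume)
    (hlim : ∀ᵐ x, Tendsto (fun n => F n x) atTop (𝓝 (g x)))
    (hC : ∀ n, ∫⁻ x, ‖F n x‖ₑ ^ 2 ≤ C) : ∫⁻ x, ‖g x‖ₑ ^ 2 ≤ C := by
  calc ∫⁻ x, ‖g x‖ₑ ^ 2 = ∫⁻ x, liminf (fun n => ‖F n x‖ₑ ^ 2) atTop := by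
        refine lintegral_congr_ae ?_
        filter_upwards [hlim] with x hx
        exact (((ENNReal.continuous_pow 2).tendsto _).comp
          ((continuous_enorm.tendsto _).comp hx)).liminf_eq.symm
    _ ≤ liminf (fun n => ∫⁻ x, ‖F n x‖ₑ ^ 2) atTop :=
        lintegral_liminf_le' fun n => (hF n).enorm.pow_const 2
    _ ≤ C := by
        refine (liminf_le_liminf (.of_forall hC)).trans ?_
        simp

theorem memLp_two_of_bounded {h : ℝ → ℂ} (hh : Integrable h) {C : ℝ} (hC : ∀ x, ‖h x‖ ≤ C) :
    MemLp h 2 := by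
  rw [memLp_two_iff_integrable_sq_norm hh.1]
  simp only [pow_two]
  exact hh.norm.bdd_mul hh.1.norm (.of_forall fun x => by simpa using hC x)

theorem ft_eq_Fk (f : ℝ → ℂ) : ft f = Fk (fun y => y) f := rfl

theorem norm_exp_neg_I_mul (k u : ℝ) : ‖Complex.exp (-Complex.I * k * u)‖ = 1 := by
  rw [Complex.norm_exp]; simp

theorem continuous_Fk {x : ℝ → ℝ} (hx : Measurable x) {f : ℝ → ℂ} (hf : Integrable f) :
    Continuous (Fk x f) := by
  refine continuous_const.mul (continuous_of_dominated (bound := fun y => ‖f y‖) ?_ ?_ hf.norm ?_)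
  · exact fun k => hf.1.mul (by fun_prop)
  · exact fun k => .of_forall fun y => by rw [norm_mul, norm_exp_neg_I_mul, mul_one]
  · exact .of_forall fun y => by fun_prop

theorem ft_zero_of_ae {f : ℝ → ℂ} (hf : Integrable f) (hfp : ∀ᵐ p : ℝ, p ≤ 0 → ft f p = 0) :
    ft f 0 = 0 := by
  have hd := (Measure.dense_of_ae hfp).open_subset_closure_inter (isOpen_Iio (a := (0 : ℝ)))
  have hcl : IsClosed {p | ft f p = 0} :=
    isClosed_eq (ft_eq_Fk f ▸ continuous_Fk measurable_id hf) continuous_const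
  have h0 : (0 : ℝ) ∈ closure (Iio 0) := by rw [closure_Iio]; simp
  exact hcl.closure_subset_iff.mpr (fun p hp => hp.2 hp.1.le) (closure_minimal hd isClosed_closure h0)

theorem integral_eq_zero_of_ft_zero {f : ℝ → ℂ} (h : ft f 0 = 0) : ∫ y, f y = 0 := by
  have : Real.sqrt (2 * Real.pi) ≠ 0 := (Real.sqrt_pos.2 (by positivity)).ne'
  have hc : (Real.sqrt (2 * Real.pi) : ℂ)⁻¹ ≠ 0 := inv_ne_zero (by exact_mod_cast this)
  rw [ft] at h
  simpa using (mul_eq_zero.1 h).resolve_left hc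

theorem norm_exp_damped_le {ε u : ℝ} (hε : 0 ≤ ε) (hu : u ≤ 0) (k : ℝ) :
    ‖Complex.exp ((ε - Complex.I * k) * u)‖ ≤ 1 := by
  rw [Complex.norm_exp]
  have : ε * u ≤ 0 := mul_nonpos_of_nonneg_of_nonpos hε hu
  simpa using this

/-- The mass of `f` on the sublevel set `{s | x s ≤ u}`. -/
noncomputable def sublevelIntegral (x : ℝ → ℝ) (f : ℝ → ℂ) (u : ℝ) : ℂ :=
  ∫ s, {s | x s ≤ u}.indicator f s

theorem norm_sublevelIntegral_le (x : ℝ → ℝ) {f : ℝ → ℂ} (hf : Integrable f) (u : ℝ) :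
    ‖sublevelIntegral x f u‖ ≤ ∫ s, ‖f s‖ :=
  norm_integral_le_of_norm_le hf.norm (.of_forall fun _ => norm_indicator_le_norm_self _ _)

theorem aestronglyMeasurable_sublevel_integrand {x : ℝ → ℝ} (hx : Measurable x) {f : ℝ → ℂ}
    (hf : Integrable f) {μ : Measure ℝ} [SFinite μ] :
    AEStronglyMeasurable (fun z : ℝ × ℝ => {s | x s ≤ z.1}.indicator f z.2) (μ.prod volume) := by
  have hs : MeasurableSet {z : ℝ × ℝ | x z.2 ≤ z.1} :=
    measurableSet_le (hx.comp measurable_snd) measurable_fst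
  exact (hf.1.comp_snd (μ := μ)).indicator hs

theorem aestronglyMeasurable_sublevelIntegral {x : ℝ → ℝ} (hx : Measurable x) {f : ℝ → ℂ}
    (hf : Integrable f) : AEStronglyMeasurable (sublevelIntegral x f) volume :=
  (aestronglyMeasurable_sublevel_integrand hx hf).integral_prod_right'

/-- The truncated, exponentially damped primitive of the pushforward of `f` along `x`. -/
noncomputable def dampedPrimitive (x : ℝ → ℝ) (f : ℝ → ℂ) (ε : ℝ) : ℝ → ℂ :=
  (Iio 0).indicator fun u => Complex.exp (ε * u) * sublevelIntegral x f u

theorem integrable_dampedPrimitive {x : ℝ → ℝ} (hx : Measurable x) {f : ℝ → ℂ}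
    (hf : Integrable f) {ε : ℝ} (hε : 0 < ε) : Integrable (dampedPrimitive x f ε) := by
  refine IntegrableOn.integrable_indicator ?_ measurableSet_Iio
  have h1 : IntegrableOn (fun u : ℝ => Complex.exp (ε * u)) (Iio 0) :=
    (integrableOn_exp_mul_complex_Iic (a := ε) (by simpa using hε) 0).mono_set Iio_subset_Iic_self
  exact h1.mul_bdd (aestronglyMeasurable_sublevelIntegral hx hf).restrict
    (.of_forall (norm_sublevelIntegral_le x hf))

theorem norm_dampedPrimitive_le (x : ℝ → ℝ) (f : ℝ → ℂ) {ε : ℝ} (hε : 0 < ε) (u : ℝ) :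
    ‖dampedPrimitive x f ε u‖ ≤ ‖(Iio 0).indicator (sublevelIntegral x f) u‖ := by
  by_cases hu : u ∈ Iio 0
  · rw [dampedPrimitive, indicator_of_mem hu, indicator_of_mem hu, norm_mul]
    refine mul_le_of_le_one_left (norm_nonneg _) ?_
    rw [Complex.norm_exp]
    have : ε * u ≤ 0 := mul_nonpos_of_nonneg_of_nonpos hε.le (le_of_lt hu)
    simpa using this
  · simp [dampedPrimitive, indicator_of_notMem hu]

theorem memLp_dampedPrimitive {x : ℝ → ℝ} (hx : Measurable x) {f : ℝ → ℂ}
    (hf : Integrable f) {ε : ℝ} (hε : 0 < ε) : MemLp (dampedPrimitive x f ε) 2 :=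
  memLp_two_of_bounded (integrable_dampedPrimitive hx hf hε) fun u =>
    (norm_dampedPrimitive_le x f hε u).trans
      ((norm_indicator_le_norm_self _ _).trans (norm_sublevelIntegral_le x hf u))

theorem ft_dampedPrimitive {x : ℝ → ℝ} (hx : Measurable x) (hx0 : ∀ y, x y < 0) {f : ℝ → ℂ}
    (hf : Integrable f) (hf0 : ∫ y, f y = 0) {ε : ℝ} (hε : 0 < ε) (k : ℝ) :
    ft (dampedPrimitive x f ε) k = -((ε - Complex.I * k)⁻¹ * ((Real.sqrt (2 * Real.pi) : ℂ)⁻¹ *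
      ∫ y, f y * Complex.exp ((ε - Complex.I * k) * x y))) := by
  set a : ℂ := ε - Complex.I * k with ha
  have hare : a.re = ε := by simp [ha]
  have ha0 : a ≠ 0 := fun h => hε.ne' (by rw [← hare, h, Complex.zero_re])
  have hexp : IntegrableOn (fun u : ℝ => Complex.exp (a * u)) (Iio 0) :=
    (integrableOn_exp_mul_complex_Iic (by rwa [hare]) 0).mono_set Iio_subset_Iic_self
  have hswap : Integrable (Function.uncurry fun (u s : ℝ) =>
      Complex.exp (a * u) * {s | x s ≤ u}.indicator f s)
      ((volume.restrict (Iio 0)).prod volume) := by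
    refine (hexp.mul_prod hf).mono ?_ (.of_forall fun z => ?_)
    · exact AEStronglyMeasurable.mul (by fun_prop) (aestronglyMeasurable_sublevel_integrand hx hf)
    · simp only [Function.uncurry, norm_mul]
      gcongr
      exact norm_indicator_le_norm_self _ _
  have hinner : ∀ s, ∫ u : ℝ in Iio 0, Complex.exp (a * u) * {s | x s ≤ u}.indicator f s
      = f s * (1 / a) - a⁻¹ * (f s * Complex.exp (a * x s)) := by
    intro s
    have : ∀ u : ℝ, Complex.exp (a * u) * {s | x s ≤ u}.indicator f s
        = f s * (Ici (x s)).indicator (fun u : ℝ => Complex.exp (a * u)) u := by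
      intro u
      by_cases h : x s ≤ u <;> simp [indicator, h, mul_comm]
    simp_rw [this]
    rw [integral_const_mul, setIntegral_indicator measurableSet_Ici, Iio_inter_Ici,
      ← integral_Icc_eq_integral_Ico, integral_Icc_eq_integral_Ioc,
      ← intervalIntegral.integral_of_le (hx0 s).le, integral_exp_mul_complex ha0]
    simp
    field_simp
  have hfe : Integrable fun s => f s * Complex.exp (a * x s) := by
    exact hf.mul_bdd (c := 1) (by fun_prop)
      (.of_forall fun s => norm_exp_damped_le hε.le (hx0 s).le k)
  have hmain : ∫ u, dampedPrimitive x f ε u * Complex.exp (-Complex.I * k * u)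
      = -(a⁻¹ * ∫ y, f y * Complex.exp (a * x y)) := by
    calc _ = ∫ u : ℝ in Iio 0, ∫ s, Complex.exp (a * u) * {s | x s ≤ u}.indicator f s := by
          rw [← integral_indicator measurableSet_Iio]
          congr 1 with u
          by_cases hu : u ∈ Iio 0
          · rw [dampedPrimitive, indicator_of_mem hu, indicator_of_mem hu, integral_const_mul,
              mul_right_comm, ← Complex.exp_add, sublevelIntegral]
            congr 2
            rw [ha]; ring
          · simp [dampedPrimitive, indicator_of_notMem hu]
      _ = ∫ s, ∫ u : ℝ in Iio 0, Complex.exp (a * u) * {s | x s ≤ u}.indicator f s :=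
          integral_integral_swap hswap
      _ = _ := by
          simp_rw [hinner]
          rw [integral_sub (hf.mul_const _) (hfe.const_mul _), integral_mul_const, hf0,
            integral_const_mul]
          simp
  rw [ft, hmain]
  ring

theorem lintegral_Fk_div_le {x : ℝ → ℝ} (hx : Measurable x) (hx0 : ∀ y, x y < 0) {f : ℝ → ℂ}
    (hf : Integrable f) (hf0 : ∫ y, f y = 0) :
    ∫⁻ k : ℝ, ‖Fk x f k / k‖ₑ ^ 2 ≤ ∫⁻ u in Iio 0, ‖sublevelIntegral x f u‖ₑ ^ 2 := by
  have hε : ∀ n : ℕ, (0 : ℝ) < 1 / ((n : ℝ) + 1) := fun n => by positivity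
  have hε0 : Tendsto (fun n : ℕ => ((1 / ((n : ℝ) + 1) : ℝ) : ℂ)) atTop (𝓝 0) := by
    exact_mod_cast (Complex.continuous_ofReal.tendsto 0).comp
      tendsto_one_div_add_atTop_nhds_zero_nat
  calc ∫⁻ k : ℝ, ‖Fk x f k / k‖ₑ ^ 2
      = ∫⁻ k : ℝ, ‖-((0 - Complex.I * k)⁻¹ * Fk x f k)‖ₑ ^ 2 := by
        refine lintegral_congr fun k => ?_
        congr 1
        simp only [← ofReal_norm]
        simp [div_eq_inv_mul]
    _ ≤ _ := ?_
  refine lintegral_enorm_sq_le_of_tendsto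
    (F := fun n => ft (dampedPrimitive x f (1 / ((n : ℝ) + 1)))) (fun n => ?_) ?_ (fun n => ?_)
  · rw [ft_eq_Fk]
    exact (continuous_Fk measurable_id
      (integrable_dampedPrimitive hx hf (hε n))).aestronglyMeasurable
  · filter_upwards [Measure.ae_ne volume (0 : ℝ)] with k hk
    simp_rw [ft_dampedPrimitive hx hx0 hf hf0 (hε _)]
    have h1 := hε0.sub_const (Complex.I * k)
    refine ((h1.inv₀ (by simpa using hk)).mul (tendsto_const_nhds.mul ?_)).neg
    refine tendsto_integral_of_dominated_convergence (fun y => ‖f y‖) (fun n => ?_) hf.norm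
      (fun n => .of_forall fun y => ?_) (.of_forall fun y => ?_)
    · exact hf.1.mul (by fun_prop)
    · rw [norm_mul]
      exact mul_le_of_le_one_right (norm_nonneg _) (norm_exp_damped_le (hε n).le (hx0 y).le k)
    · have h2 : Tendsto (fun n : ℕ => f y * Complex.exp
          ((((1 / ((n : ℝ) + 1) : ℝ) : ℂ) - Complex.I * k) * x y)) atTop
          (𝓝 (f y * Complex.exp ((0 - Complex.I * k) * x y))) :=
        tendsto_const_nhds.mul ((Complex.continuous_exp.tendsto _).comp (h1.mul_const _))
      simpa using h2
  · rw [lintegral_enorm_ft_sq (integrable_dampedPrimitive hx hf (hε n))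
      (memLp_dampedPrimitive hx hf (hε n)), ← lintegral_indicator measurableSet_Iio]
    refine lintegral_mono fun u => ?_
    have := pow_le_pow_left' (enorm_le_iff_norm_le.2 (norm_dampedPrimitive_le x f (hε n) u)) 2
    refine this.trans ?_
    by_cases hu : u ∈ Iio 0
    · simp [indicator_of_mem hu]
    · simp [indicator_of_notMem hu]

/-- The damped half-line kernel `t ↦ e^{-εt}` on `[0, ∞)`. -/
noncomputable def expKernel (ε : ℝ) : ℝ → ℂ :=
  (Ici 0).indicator fun t => Complex.exp (-ε * t)

theorem integrable_expKernel {ε : ℝ} (hε : 0 < ε) : Integrable (expKernel ε) := by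
  refine IntegrableOn.integrable_indicator ?_ measurableSet_Ici
  rw [integrableOn_Ici_iff_integrableOn_Ioi]
  exact integrableOn_exp_mul_complex_Ioi (by simpa using hε) 0

theorem norm_expKernel_le {ε : ℝ} (hε : 0 < ε) (t : ℝ) : ‖expKernel ε t‖ ≤ 1 := by
  by_cases ht : t ∈ Ici (0 : ℝ)
  · rw [expKernel, indicator_of_mem ht, Complex.norm_exp]
    have : 0 ≤ ε * t := mul_nonneg hε.le ht
    simpa using this
  · simp [expKernel, indicator_of_notMem ht]

theorem ft_expKernel {ε : ℝ} (hε : 0 < ε) (p : ℝ) :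
    ft (expKernel ε) p = (Real.sqrt (2 * Real.pi) : ℂ)⁻¹ * (ε + Complex.I * p)⁻¹ := by
  have hre : (-(ε + Complex.I * p : ℂ)).re < 0 := by simpa using hε
  rw [ft]
  congr 1
  calc _ = ∫ t : ℝ in Ioi 0, Complex.exp (-(ε + Complex.I * p) * t) := by
        rw [← integral_Ici_eq_integral_Ioi, ← integral_indicator measurableSet_Ici]
        congr 1 with t
        by_cases ht : t ∈ Ici (0 : ℝ)
        · rw [expKernel, indicator_of_mem ht, indicator_of_mem ht, ← Complex.exp_add]
          congr 1
          ring
        · simp [expKernel, indicator_of_notMem ht]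
    _ = _ := by
        rw [integral_exp_mul_complex_Ioi hre]
        simp only [Complex.ofReal_zero, mul_zero, Complex.exp_zero, neg_div_neg_eq, one_div]

/-- The exponentially damped primitive of `f`. -/
noncomputable def dampedConvolution (f : ℝ → ℂ) (ε : ℝ) : ℝ → ℂ :=
  convolution f (expKernel ε) (ContinuousLinearMap.mul ℂ ℂ) volume

theorem dampedConvolution_apply (f : ℝ → ℂ) (ε y : ℝ) :
    dampedConvolution f ε y = ∫ s, f s * expKernel ε (y - s) := rfl

theorem integrable_dampedConvolution {f : ℝ → ℂ} (hf : Integrable f) {ε : ℝ} (hε : 0 < ε) :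
    Integrable (dampedConvolution f ε) :=
  hf.integrable_convolution _ (integrable_expKernel hε)

theorem norm_mul_expKernel_le (f : ℝ → ℂ) {ε : ℝ} (hε : 0 < ε) (y s : ℝ) :
    ‖f s * expKernel ε (y - s)‖ ≤ ‖f s‖ := by
  rw [norm_mul]
  exact mul_le_of_le_one_right (norm_nonneg _) (norm_expKernel_le hε _)

theorem memLp_dampedConvolution {f : ℝ → ℂ} (hf : Integrable f) {ε : ℝ} (hε : 0 < ε) :
    MemLp (dampedConvolution f ε) 2 :=
  memLp_two_of_bounded (integrable_dampedConvolution hf hε) fun y =>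
    norm_integral_le_of_norm_le hf.norm (.of_forall fun s => norm_mul_expKernel_le f hε y s)

theorem ft_dampedConvolution {f : ℝ → ℂ} (hf : Integrable f) {ε : ℝ} (hε : 0 < ε) (p : ℝ) :
    ft (dampedConvolution f ε) p = (ε + Complex.I * p)⁻¹ * ft f p := by
  have h := ft_expKernel hε p
  rw [ft_eq_fourier] at h
  have hc : (Real.sqrt (2 * Real.pi) : ℂ)⁻¹ ≠ 0 :=
    inv_ne_zero (by exact_mod_cast (Real.sqrt_pos.2 (by positivity)).ne')
  rw [ft_eq_fourier, ft_eq_fourier, dampedConvolution,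
    Real.fourier_mul_convolution_eq hf (integrable_expKernel hε), mul_left_cancel₀ hc h]
  ring

theorem lintegral_sublevelIntegral_le {f : ℝ → ℂ} (hf : Integrable f) :
    ∫⁻ y, ‖sublevelIntegral (fun s => s) f y‖ₑ ^ 2 ≤ ∫⁻ p : ℝ, ‖ft f p / p‖ₑ ^ 2 := by
  have hε : ∀ n : ℕ, (0 : ℝ) < 1 / ((n : ℝ) + 1) := fun n => by positivity
  have hε0 : Tendsto (fun n : ℕ => ((1 / ((n : ℝ) + 1) : ℝ) : ℂ)) atTop (𝓝 0) := by
    exact_mod_cast (Complex.continuous_ofReal.tendsto 0).comp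
      tendsto_one_div_add_atTop_nhds_zero_nat
  refine lintegral_enorm_sq_le_of_tendsto
    (F := fun n => dampedConvolution f (1 / ((n : ℝ) + 1)))
    (fun n => (integrable_dampedConvolution hf (hε n)).1) (.of_forall fun y => ?_) (fun n => ?_)
  · simp_rw [dampedConvolution_apply]
    refine tendsto_integral_of_dominated_convergence (fun s => ‖f s‖) (fun n => ?_) hf.norm
      (fun n => .of_forall fun s => norm_mul_expKernel_le f (hε n) y s) (.of_forall fun s => ?_)
    · have : Measurable (expKernel (1 / ((n : ℝ) + 1))) :=
        Measurable.indicator (by fun_prop) measurableSet_Ici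
      exact hf.1.mul (this.comp (measurable_const.sub measurable_id)).aestronglyMeasurable
    · by_cases hs : s ≤ y
      · have h2 : Tendsto (fun n : ℕ => f s * Complex.exp
            (-((1 / ((n : ℝ) + 1) : ℝ) : ℂ) * ((y - s : ℝ) : ℂ))) atTop
            (𝓝 (f s * Complex.exp (-0 * ((y - s : ℝ) : ℂ)))) :=
          tendsto_const_nhds.mul ((Complex.continuous_exp.tendsto _).comp (hε0.neg.mul_const _))
        simpa [expKernel, indicator, hs] using h2
      · simp [expKernel, indicator, hs]
  · rw [← lintegral_enorm_ft_sq (integrable_dampedConvolution hf (hε n))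
      (memLp_dampedConvolution hf (hε n))]
    refine lintegral_mono_ae ?_
    filter_upwards [Measure.ae_ne volume (0 : ℝ)] with p hp
    rw [ft_dampedConvolution hf (hε n), div_eq_inv_mul (ft f p) (p : ℂ)]
    refine pow_le_pow_left' (enorm_le_iff_norm_le.2 ?_) 2
    rw [norm_mul, norm_mul, norm_inv, norm_inv]
    gcongr
    · simpa using hp
    · calc ‖(p : ℂ)‖ = |(((1 / ((n : ℝ) + 1) : ℝ) : ℂ) + Complex.I * p).im| := by
            simp only [Complex.add_im, Complex.ofReal_im, Complex.I_mul_im, Complex.ofReal_re,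
              zero_add, Complex.norm_real, Real.norm_eq_abs]
        _ ≤ _ := Complex.abs_im_le_norm _

theorem hasDerivAt_xC (y : ℝ) : HasDerivAt xC (Real.exp (-y) / (1 + Real.exp (-y))) y := by
  have h1 : HasDerivAt (fun y : ℝ => 1 + Real.exp (-y)) (-Real.exp (-y)) y := by
    simpa using ((hasDerivAt_neg y).exp).const_add 1
  have h2 := (h1.log (by positivity)).neg
  rwa [neg_div, neg_neg] at h2

theorem xC_neg (y : ℝ) : xC y < 0 :=
  neg_neg_of_pos (Real.log_pos (by linarith [Real.exp_pos (-y)]))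

theorem strictMono_xC : StrictMono xC := by
  refine strictMono_of_hasDerivAt_pos hasDerivAt_xC fun y => ?_
  positivity

theorem image_xC : xC '' univ = Iio 0 := by
  rw [image_univ]
  refine Subset.antisymm (range_subset_iff.2 xC_neg) fun u hu => ?_
  have h : 0 < Real.exp (-u) - 1 := by
    have := Real.one_lt_exp_iff.2 (neg_pos.2 (mem_Iio.1 hu))
    linarith
  refine ⟨-Real.log (Real.exp (-u) - 1), ?_⟩
  rw [xC, neg_neg, Real.exp_log h]
  simp

theorem measurable_xC : Measurable xC := strictMono_xC.monotone.measurable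

theorem lintegral_sublevelIntegral_xC_le (f : ℝ → ℂ) :
    ∫⁻ u in Iio 0, ‖sublevelIntegral xC f u‖ₑ ^ 2
      ≤ ∫⁻ y, ‖sublevelIntegral (fun s => s) f y‖ₑ ^ 2 := by
  rw [← image_xC, lintegral_image_eq_lintegral_abs_deriv_mul MeasurableSet.univ
    (fun y _ => (hasDerivAt_xC y).hasDerivWithinAt) strictMono_xC.injective.injOn,
    Measure.restrict_univ]
  refine lintegral_mono fun y => ?_
  have h1 : ENNReal.ofReal |Real.exp (-y) / (1 + Real.exp (-y))| ≤ 1 := by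
    rw [abs_of_pos (by positivity), ENNReal.ofReal_le_one, div_le_one (by positivity)]
    linarith
  have h2 : sublevelIntegral xC f (xC y) = sublevelIntegral (fun s => s) f y := by
    simp only [sublevelIntegral, strictMono_xC.le_iff_le]
  rw [h2]
  exact mul_le_of_le_one_left' h1

theorem lintegral_Fk_xC_div_le {f : ℝ → ℂ} (hf : Integrable f)
    (hfp : ∀ᵐ p : ℝ, p ≤ 0 → ft f p = 0) :
    ∫⁻ k : ℝ, ‖Fk xC f k / k‖ₑ ^ 2 ≤ ∫⁻ p in Ioi (0 : ℝ), ‖ft f p / p‖ₑ ^ 2 := by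
  refine (lintegral_Fk_div_le measurable_xC xC_neg hf
    (integral_eq_zero_of_ft_zero (ft_zero_of_ae hf hfp))).trans
    ((lintegral_sublevelIntegral_xC_le f).trans ((lintegral_sublevelIntegral_le hf).trans ?_))
  rw [← lintegral_indicator measurableSet_Ioi]
  refine lintegral_mono_ae ?_
  filter_upwards [hfp] with p hp
  by_cases h : p ∈ Ioi (0 : ℝ)
  · rw [indicator_of_mem h]
  · simp [hp (not_lt.1 h)]

theorem enorm_div_ofReal_sq (z : ℂ) (k : ℝ) :
    ‖z / k‖ₑ ^ 2 = ENNReal.ofReal (‖z‖ ^ 2 / k ^ 2) := by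
  rw [← ofReal_norm, ← ENNReal.ofReal_pow (norm_nonneg _), norm_div, div_pow, Complex.norm_real,
    Real.norm_eq_abs, sq_abs]

theorem No_eq_lintegral_Iio (x : ℝ → ℝ) (f : ℝ → ℂ) :
    No x f = ∫⁻ k in Iio (0 : ℝ), ENNReal.ofReal (‖Fk x f k‖ ^ 2 / (2 * -k)) := by
  rw [No, ← lintegral_indicator measurableSet_Ioi, ← lintegral_indicator measurableSet_Iio,
    ← lintegral_neg_eq_self]
  congr 1 with k
  by_cases hk : k < 0 <;> simp [indicator, hk]

theorem No_le_NthIn (x : ℝ → ℝ) (f : ℝ → ℂ) {β : ℝ} (hβ : 0 < β) : No x f ≤ NthIn x β f := by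
  rw [No_eq_lintegral_Iio, NthIn]
  refine le_trans (setLIntegral_mono' measurableSet_Iio fun k hk => ?_) (setLIntegral_le_lintegral _ _)
  have hk : k < 0 := hk
  have h1 : Real.exp (β * k) < 1 := Real.exp_lt_one_iff.2 (mul_neg_of_pos_of_neg hβ hk)
  have h2 := Real.exp_pos (β * k)
  refine ENNReal.ofReal_le_ofReal ?_
  rw [show 2 * k * (Real.exp (β * k) - 1) = 2 * -k * (1 - Real.exp (β * k)) by ring]
  refine div_le_div_of_nonneg_left (sq_nonneg _) (mul_pos (by linarith) (by linarith)) ?_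
  exact mul_le_of_le_one_right (by linarith) (by linarith)

theorem planck_le_of_pos {β k : ℝ} (hβ : 0 < β) (hk : 0 < k) :
    1 / (2 * k * (Real.exp (β * k) - 1)) ≤ 1 / (2 * β) * (1 / k ^ 2) := by
  rw [one_div_mul_one_div]
  refine one_div_le_one_div_of_le (by positivity) ?_
  have := Real.add_one_le_exp (β * k)
  nlinarith

theorem planck_le_of_neg {β k : ℝ} (hβ : 0 < β) (hk : k < 0) :
    1 / (2 * k * (Real.exp (β * k) - 1)) ≤ 1 / (2 * -k) + 1 / (2 * β) * (1 / k ^ 2) := by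
  have h := planck_le_of_pos hβ (neg_pos.2 hk)
  have h1 : Real.exp (β * k) < 1 := Real.exp_lt_one_iff.2 (mul_neg_of_pos_of_neg hβ hk)
  have h2 := Real.exp_pos (β * k)
  have h4 : 1 - Real.exp (β * k) ≠ 0 := by linarith
  have e : 1 / (2 * k * (Real.exp (β * k) - 1))
      = 1 / (2 * -k) + 1 / (2 * -k * (Real.exp (β * -k) - 1)) := by
    have hk0 := hk.ne
    rw [mul_neg β k, Real.exp_neg]
    generalize Real.exp (β * k) = E at *
    have h5 : E⁻¹ - 1 = (1 - E) / E := by field_simp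
    rw [h5, show E - 1 = -(1 - E) by ring]
    field_simp
    ring
  rw [e]
  simpa using h

theorem NthIn_le {x : ℝ → ℝ} (hx : Measurable x) {f : ℝ → ℂ} (hf : Integrable f) {β : ℝ}
    (hβ : 0 < β) :
    NthIn x β f ≤ No x f + ENNReal.ofReal (1 / (2 * β)) * ∫⁻ k : ℝ, ‖Fk x f k / k‖ₑ ^ 2 := by
  have hm : Measurable (Fk x f) := (continuous_Fk hx hf).measurable
  rw [No_eq_lintegral_Iio, ← lintegral_indicator measurableSet_Iio,
    ← lintegral_const_mul _ (by fun_prop), ← lintegral_add_right _ (by fun_prop), NthIn]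
  refine lintegral_mono_ae ?_
  filter_upwards [Measure.ae_ne volume (0 : ℝ)] with k hk
  rw [enorm_div_ofReal_sq, ← ENNReal.ofReal_mul (by positivity)]
  have hF := sq_nonneg ‖Fk x f k‖
  rcases lt_or_gt_of_ne hk with h | h
  · rw [indicator_of_mem (mem_Iio.2 h), ← ENNReal.ofReal_add
      (div_nonneg hF (by linarith)) (by positivity)]
    refine ENNReal.ofReal_le_ofReal ?_
    have := mul_le_mul_of_nonneg_left (planck_le_of_neg hβ h) hF
    refine (le_of_eq ?_).trans (this.trans (le_of_eq ?_)) <;> ring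
  · rw [indicator_of_notMem (by simpa using h.le), zero_add]
    refine ENNReal.ofReal_le_ofReal ?_
    have := mul_le_mul_of_nonneg_left (planck_le_of_pos hβ h) hF
    refine (le_of_eq ?_).trans (this.trans (le_of_eq ?_)) <;> ring

/-- For the CGHS map, integrable `f` with `f̂(p) = 0` for a.e. `p ≤ 0`,
and `β > 0`, one has `0 ≤ N̄^Th_{β,in}[f] - N̄_o[f] ≤ (1/(2β)) ∫_0^∞ |f̂(p)|²/p² dp`
in `[0,∞]`. -/
theorem stmt_18 (f : ℝ → ℂ) (hf : MeasureTheory.Integrable f)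
    (hfp : ∀ᵐ p : ℝ, p ≤ 0 → ft f p = 0) (β : ℝ) (hβ : 0 < β) :
    No xC f ≤ NthIn xC β f ∧
    NthIn xC β f - No xC f ≤ ENNReal.ofReal (1 / (2 * β)) *
      ∫⁻ p in Set.Ioi (0:ℝ), ENNReal.ofReal (‖ft f p‖ ^ 2 / p ^ 2) := by
  refine ⟨No_le_NthIn xC f hβ, tsub_le_iff_left.2 ((NthIn_le measurable_xC hf hβ).trans ?_)⟩
  refine add_le_add le_rfl (mul_le_mul' le_rfl ?_)
  refine (lintegral_Fk_xC_div_le hf hfp).trans_eq ?_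
  simp_rw [enorm_div_ofReal_sq]
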